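/- Let R be a commutative ring and let α_0, …, α_n be a regular sequence on R such that each α_i is a non-zero-divisor of R; let I = (α_0, …, α_n). If M is an I-power torsion R-module, then the natural map H_I^0(M) → M (induced by the isomorphism of H_I^0 with the I-power torsion submodule) is an isomorphism, and H_I^i(M) = 0 for all i > 0. -/

import Mathlib

open CategoryTheory

universe u

/-- The submodule of `I`-power torsion elements of `M`. -/
def Ideal.powTorsion {R : Type u} [CommRing R] (I : Ideal R) (M : Type u) [AddCommGroup M]
    [Module R M] : Submodule R M where
  carrier := {m | ∃ j : ℕ, 1 ≤ j ∧ ∀ r ∈ I ^ j, r • m = 0}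
  zero_mem' := ⟨1, le_refl 1, fun r _ => smul_zero r⟩
  add_mem' := by
    rintro a b ⟨j, hj1, hj⟩ ⟨k, hk1, hk⟩
    refine ⟨j + k, le_add_right hj1, fun r hr => ?_⟩
    rw [smul_add, hj r (Ideal.pow_le_pow_right (Nat.le_add_right j k) hr),
      hk r (Ideal.pow_le_pow_right (Nat.le_add_left k j) hr), add_zero]
  smul_mem' := by
    rintro c m ⟨j, hj1, hj⟩
    exact ⟨j, hj1, fun r hr => by rw [smul_comm, hj r hr, smul_zero]⟩

open RingTheory.Sequence Limits

theorem CategoryTheory.ShortComplex.ShortExact.mk₀_comp_extClass {C : Type*} [Category* C]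
    [Abelian C] [HasExt C] {S₁ S₂ : ShortComplex C} (h₁ : S₁.ShortExact) (h₂ : S₂.ShortExact)
    (f : S₁ ⟶ S₂) :
    (Abelian.Ext.mk₀ f.τ₃).comp h₂.extClass (zero_add 1) =
      h₁.extClass.comp (Abelian.Ext.mk₀ f.τ₁) (add_zero 1) := by
  let := HasDerivedCategory.standard C
  ext
  have := (ShortComplex.ShortExact.singleTriangle.map h₁ h₂ f).comm₃
  simp only [Abelian.Ext.comp_hom, Abelian.Ext.mk₀_hom, extClass_hom]
  exact ((ShiftedHom.mk₀_comp _ _ _ _).trans this.symm).trans (ShiftedHom.comp_mk₀ _ _ _ _).symm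

theorem RingTheory.Sequence.IsWeaklyRegular.of_exact {R : Type*} [CommRing R]
    {A B C : Type*} [AddCommGroup A] [Module R A] [AddCommGroup B] [Module R B] [AddCommGroup C]
    [Module R C] (f : A →ₗ[R] B) (g : B →ₗ[R] C)
    (hf : Function.Injective f) (hfg : Function.Exact f g) (hg : Function.Surjective g)
    {l : List R} (hA : IsWeaklyRegular A l) (hC : IsWeaklyRegular C l) : IsWeaklyRegular B l := by
  induction l generalizing A B C with
  | nil => exact .nil _ _
  | cons x l ih =>
    rw [isWeaklyRegular_cons_iff] at hA hC ⊢
    refine ⟨isSMulRegular_of_range_eq_ker hf (LinearMap.exact_iff.1 hfg).symm hA.1 hC.1,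
      ih (QuotSMulTop.map x f) (QuotSMulTop.map x g) ?_ ?_ ?_ hA.2 hC.2⟩
    · have h0 : Function.Exact (0 : A →ₗ[R] A) f :=
        LinearMap.exact_zero_iff_injective _ _ |>.2 hf
      have h1 := QuotSMulTop.map_first_exact_on_four_term_exact_of_isSMulRegular_last h0 hfg hC.1
      rw [map_zero] at h1
      exact LinearMap.exact_zero_iff_injective _ _ |>.1 h1
    · exact QuotSMulTop.map_exact x hfg hg
    · exact QuotSMulTop.map_surjective x hg

theorem RingTheory.Sequence.IsWeaklyRegular.of_subsingleton {R : Type*} [CommRing R]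
    {M : Type*} [AddCommGroup M] [Module R M] [Subsingleton M] (l : List R) :
    IsWeaklyRegular M l := by
  induction l generalizing M with
  | nil => exact .nil _ _
  | cons y l ih => exact .cons (Function.injective_of_subsingleton _) ih

open Pointwise in
theorem RingTheory.Sequence.IsWeaklyRegular.quotSMulTop_pow {R : Type*} [CommRing R]
    {M : Type*} [AddCommGroup M] [Module R M] {x : R} (hx : IsSMulRegular M x)
    {l : List R} (h : IsWeaklyRegular (QuotSMulTop x M) l) (j : ℕ) :
    IsWeaklyRegular (QuotSMulTop (x ^ j) M) l := by
  induction j with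
  | zero =>
    have : Subsingleton (QuotSMulTop (x ^ 0) M) := by
      rw [pow_zero, QuotSMulTop, one_smul]; infer_instance
    exact .of_subsingleton l
  | succ j ih =>
    have h1 : x • (⊤ : Submodule R M) ≤
        (x ^ (j + 1) • ⊤ : Submodule R M).comap (LinearMap.lsmul R M (x ^ j)) := by
      rintro _ ⟨m, -, rfl⟩
      exact ⟨m, trivial, by simp [pow_succ, mul_smul, smul_comm x]⟩
    have h2 : (x ^ (j + 1) • ⊤ : Submodule R M) ≤
        (x ^ j • ⊤ : Submodule R M).comap LinearMap.id := by
      rintro _ ⟨m, -, rfl⟩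
      exact ⟨x • m, trivial, by simp [pow_succ, mul_smul, smul_comm x]⟩
    refine .of_exact (Submodule.mapQ _ _ _ h1) (Submodule.mapQ _ _ _ h2) ?_ ?_ ?_ h ih
    · rw [← LinearMap.ker_eq_bot, LinearMap.ker_eq_bot']
      intro m hm
      obtain ⟨m, rfl⟩ := Submodule.mkQ_surjective _ m
      obtain ⟨m', -, h'⟩ := (Submodule.Quotient.mk_eq_zero _).1 hm
      refine (Submodule.Quotient.mk_eq_zero _).2 ⟨m', trivial, (hx.pow j) ?_⟩
      simpa [pow_succ, mul_smul] using h'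
    · intro m
      obtain ⟨m, rfl⟩ := Submodule.mkQ_surjective _ m
      constructor
      · intro hm
        obtain ⟨m', -, h'⟩ := (Submodule.Quotient.mk_eq_zero _).1 hm
        exact ⟨Submodule.Quotient.mk m', congrArg Submodule.Quotient.mk h'⟩
      · rintro ⟨m', hm⟩
        obtain ⟨m', rfl⟩ := Submodule.mkQ_surjective _ m'
        rw [← hm]
        exact (Submodule.Quotient.mk_eq_zero _).2 ⟨m', trivial, rfl⟩
    · intro m
      obtain ⟨m, rfl⟩ := Submodule.mkQ_surjective _ m
      exact ⟨Submodule.Quotient.mk m, rfl⟩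

theorem RingTheory.Sequence.IsWeaklyRegular.map_pow_append {R : Type*} [CommRing R]
    {M : Type*} [AddCommGroup M] [Module R M] {l t : List R}
    (h : IsWeaklyRegular M (l ++ t)) (j : ℕ) : IsWeaklyRegular M (l.map (· ^ j) ++ t) := by
  induction l generalizing M with
  | nil => exact h
  | cons x l ih =>
    rw [List.cons_append, isWeaklyRegular_cons_iff] at h
    rw [List.map_cons, List.cons_append, isWeaklyRegular_cons_iff]
    exact ⟨h.1.pow j, (ih h.2).quotSMulTop_pow h.1 j⟩

/-- The projection `R ⧸ I ⟶ R ⧸ J` for `I ≤ J`, as a morphism of `R`-modules. -/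
abbrev Ideal.quotMap {R : Type u} [CommRing R] {I J : Ideal R} (h : I ≤ J) :
    ModuleCat.of R (R ⧸ I) ⟶ ModuleCat.of R (R ⧸ J) :=
  ModuleCat.ofHom (Submodule.mapQ I J LinearMap.id h)

theorem Ideal.quotMap_comp {R : Type u} [CommRing R] {I J K : Ideal R} (h : I ≤ J) (h' : J ≤ K) :
    Ideal.quotMap h ≫ Ideal.quotMap h' = Ideal.quotMap (h.trans h') := by
  ext
  rfl

/-- Every positive degree class in `Ext (R ⧸ J j) M` dies in `Ext (R ⧸ J k) M` for some `k ≥ j`. -/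
def ExtProZero {R : Type u} [CommRing R] (J : ℕ → Ideal R) (M : ModuleCat.{u} R) : Prop :=
  ∀ (i j : ℕ) (ξ : Abelian.Ext (ModuleCat.of R (R ⧸ J j)) M (i + 1)),
    ∃ (k : ℕ) (_ : j ≤ k) (h : J k ≤ J j),
      (Abelian.Ext.mk₀ (Ideal.quotMap h)).comp ξ (zero_add (i + 1)) = 0

/-- The complex `R ⧸ J ⟶ R ⧸ J ⟶ R ⧸ (J ⊔ (y))` whose first map is multiplication by `y`. -/
abbrev Ideal.quotMulComplex {R : Type u} [CommRing R] (J : Ideal R) (y : R) :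
    ShortComplex (ModuleCat.{u} R) where
  f := y • 𝟙 (ModuleCat.of R (R ⧸ J))
  g := Ideal.quotMap (le_sup_left : J ≤ J ⊔ Ideal.span {y})
  zero := by
    ext
    exact (Submodule.Quotient.mk_eq_zero _).2
      (Ideal.mem_sup_right (Ideal.mul_mem_right _ _ (Ideal.mem_span_singleton_self y)))

theorem Ideal.quotMulComplex_shortExact {R : Type u} [CommRing R] (J : Ideal R) (y : R)
    (hy : ∀ r, y * r ∈ J → r ∈ J) : (J.quotMulComplex y).ShortExact where
  exact := by
    rw [ShortComplex.moduleCat_exact_iff]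
    intro m hm
    obtain ⟨m, rfl⟩ := Submodule.mkQ_surjective _ m
    have hm : m ∈ J ⊔ Ideal.span {y} := (Submodule.Quotient.mk_eq_zero _).1 hm
    obtain ⟨a, ha, b, hb, rfl⟩ := Submodule.mem_sup.1 hm
    obtain ⟨c, rfl⟩ := Ideal.mem_span_singleton'.1 hb
    refine ⟨Submodule.Quotient.mk c, (Submodule.Quotient.eq _).2 ?_⟩
    change y * c - (a + c * y) ∈ J
    convert J.neg_mem ha using 1
    ring
  mono_f := by
    rw [ModuleCat.mono_iff_injective, injective_iff_map_eq_zero]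
    intro m hm
    obtain ⟨m, rfl⟩ := Submodule.mkQ_surjective _ m
    exact (Submodule.Quotient.mk_eq_zero _).2 (hy m ((Submodule.Quotient.mk_eq_zero _).1 hm))
  epi_g := by
    rw [ModuleCat.epi_iff_surjective]
    intro m
    obtain ⟨m, rfl⟩ := Submodule.mkQ_surjective _ m
    exact ⟨Submodule.Quotient.mk m, rfl⟩

theorem Ideal.quotMul_sup_le {R : Type u} [CommRing R] {J K : Ideal R} (h : K ≤ J) (x : R) {j k : ℕ}
    (hjk : j ≤ k) : K ⊔ Ideal.span {x ^ k} ≤ J ⊔ Ideal.span {x ^ j} :=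
  sup_le_sup h (Ideal.span_singleton_le_span_singleton.2 (pow_dvd_pow x hjk))

/-- The map of complexes `Ideal.quotMulComplex` induced by the inclusion of ideals `K ≤ J`. -/
abbrev Ideal.quotMulComplexMap {R : Type u} [CommRing R] {J K : Ideal R} (h : K ≤ J) (x : R)
    {j k : ℕ} (hjk : j ≤ k) : K.quotMulComplex (x ^ k) ⟶ J.quotMulComplex (x ^ j) where
  τ₁ := x ^ (k - j) • Ideal.quotMap h
  τ₂ := Ideal.quotMap h
  τ₃ := Ideal.quotMap (Ideal.quotMul_sup_le h x hjk)
  comm₁₂ := by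
    simp [smul_smul, ← pow_add, Nat.add_sub_cancel' hjk]
  comm₂₃ := by
    simp [Ideal.quotMap_comp]

open Abelian in
theorem ExtProZero.sup_span_pow {R : Type u} [CommRing R] {J : ℕ → Ideal R} (hJ : Antitone J)
    {M : ModuleCat.{u} R} (x : R) (hx : ∀ j r, x ^ j * r ∈ J j → r ∈ J j)
    (hM : ∀ m : M, ∃ N : ℕ, x ^ N • m = 0) (h : ExtProZero J M) :
    ExtProZero (fun j => J j ⊔ Ideal.span {x ^ j}) M := by
  intro i j ξ
  obtain ⟨k, hjk, hk, hξ⟩ := h i j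
    ((Ext.mk₀ (Ideal.quotMulComplex (J j) (x ^ j)).g).comp ξ (zero_add _))
  let S := fun k => (J k).quotMulComplex_shortExact (x ^ k) (hx k)
  obtain ⟨η, hη⟩ := Ext.contravariant_sequence_exact₃ (S k) _
    ((Ext.mk₀ (Ideal.quotMap (Ideal.quotMul_sup_le hk x hjk))).comp ξ (zero_add _))
    (by
      rw [← hξ]
      simp only [Ext.mk₀_comp_mk₀_assoc, Ideal.quotMap_comp]) (add_comm 1 i)
  obtain ⟨l, hkl, hl⟩ : ∃ (l : ℕ) (hkl : k ≤ l),
      x ^ (l - k) • (Ext.mk₀ (Ideal.quotMap (hJ hkl))).comp η (zero_add i) = 0 := by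
    cases i with
    | zero =>
      obtain ⟨f, rfl⟩ := Ext.homEquiv₀.symm.surjective η
      obtain ⟨N, hN⟩ := hM (f (Submodule.Quotient.mk 1))
      refine ⟨k + N, by lia, ?_⟩
      simp only [Ext.homEquiv₀_symm_apply, Ext.mk₀_comp_mk₀, ← Ext.mk₀_smul]
      rw [Ext.mk₀_eq_zero_iff]
      ext
      change x ^ (k + N - k) • f (Submodule.Quotient.mk 1) = 0
      rwa [Nat.add_sub_cancel_left]
    | succ i =>
      obtain ⟨l, hkl, hl, hη⟩ := h i k η
      exact ⟨l, hkl, by rw [hη, smul_zero]⟩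
  refine ⟨l, hjk.trans hkl, Ideal.quotMul_sup_le (hJ (hjk.trans hkl)) x (hjk.trans hkl), ?_⟩
  have nat := (S l).mk₀_comp_extClass (S k) (Ideal.quotMulComplexMap (hJ hkl) x hkl)
  have e := congrArg ((Ext.mk₀ (Ideal.quotMap (Ideal.quotMul_sup_le (hJ hkl) x hkl))).comp ·
    (zero_add _)) hη
  simp only [Ext.mk₀_comp_mk₀_assoc, Ideal.quotMap_comp] at e
  rw [← e, ← Ext.comp_assoc _ _ _ (zero_add 1) _ (by lia)]
  refine (congrArg (Ext.comp · η _) nat).trans ?_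
  rw [Ext.comp_assoc _ _ _ (add_zero 1) (zero_add i) (by lia), Ext.mk₀_smul, Ext.smul_comp, hl,
    Ext.comp_zero]

theorem Ideal.ofList_map_pow_antitone {R : Type u} [CommRing R] (l : List R) :
    Antitone fun j : ℕ => Ideal.ofList (l.map (· ^ j)) := by
  intro j k hjk
  refine Ideal.span_le.2 fun y hy => ?_
  obtain ⟨a, ha, rfl⟩ := List.mem_map.1 hy
  exact Ideal.mem_of_dvd _ (pow_dvd_pow a hjk)
    (Ideal.subset_span (List.mem_map.2 ⟨a, ha, rfl⟩))

theorem ExtProZero.ofList {R : Type u} [CommRing R] (l : List R) (hl : IsWeaklyRegular R l)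
    (M : ModuleCat.{u} R) (hM : ∀ x ∈ l, ∀ m : M, ∃ N : ℕ, x ^ N • m = 0) :
    ExtProZero (fun j => Ideal.ofList (l.map (· ^ j))) M := by
  induction l using List.reverseRecOn with
  | nil =>
    intro i j ξ
    have : Projective (ModuleCat.of R (R ⧸ Ideal.ofList (([] : List R).map (· ^ j)))) := by
      rw [List.map_nil, Ideal.ofList_nil]
      have := Module.Projective.of_equiv (Submodule.quotEquivOfEqBot (⊥ : Ideal R) rfl).symm
      infer_instance
    exact ⟨j, le_rfl, le_rfl, by rw [Abelian.Ext.eq_zero_of_projective ξ, Abelian.Ext.comp_zero]⟩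
  | append_singleton l x ih =>
    have h := (ih ((isWeaklyRegular_append_iff _ _ _).1 hl).1
      fun y hy => hM y (by simp [hy])).sup_span_pow (Ideal.ofList_map_pow_antitone l) x
      (fun j r hr => ?_) (hM x (by simp))
    · simpa using h
    · have h := ((isWeaklyRegular_append_iff _ _ _).1 (hl.map_pow_append j)).2
      rw [isWeaklyRegular_singleton_iff] at h
      simpa using mem_of_isSMulRegular_quotient_of_smul_mem (h.pow j) (x := r) (by simpa using hr)

/-- Every class in the derived functor `Ext` is governed by a class in `Abelian.Ext`: pulling it
back along `φ` gives zero as soon as pulling back the latter does. -/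
theorem Ext_map_eq_zero_of_comp {R : Type u} [CommRing R] {A M : ModuleCat.{u} R} (n : ℕ)
    (ξ : ((Ext R (ModuleCat.{u} R) (n + 1)).obj (Opposite.op A)).obj M) :
    ∃ η : Abelian.Ext A M (n + 1), ∀ (A' : ModuleCat.{u} R) (φ : A' ⟶ A),
      (Abelian.Ext.mk₀ φ).comp η (zero_add _) = 0 →
      ((Ext R (ModuleCat.{u} R) (n + 1)).map φ.op).app M ξ = 0 := by
  let P := projectiveResolution A
  let F := ((linearYoneda R (ModuleCat.{u} R)).obj M).rightOp
  obtain ⟨x, hx⟩ : ∃ x, (P.isoExt (R := R) (n + 1) M).inv x = ξ :=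
    ⟨(P.isoExt (R := R) (n + 1) M).hom ξ, by simp⟩
  obtain ⟨c, hc⟩ := (ModuleCat.epi_iff_surjective
    ((P.complex.linearYonedaObj R M).homologyπ (n + 1))).1 inferInstance x
  let f : P.complex.X (n + 1) ⟶ M := (P.complex.linearYonedaObj R M).iCycles (n + 1) c
  have hf : P.complex.d (n + 2) (n + 1) ≫ f = 0 := by
    have := ConcreteCategory.congr_hom
      ((P.complex.linearYonedaObj R M).iCycles_d (n + 1) (n + 2)) c
    exact this
  refine ⟨P.extMk f (n + 2) rfl hf, fun A' φ h => ?_⟩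
  let P' := projectiveResolution A'
  have hl : (ProjectiveResolution.lift φ P' P).f 0 ≫ P.π.f 0 = P'.π.f 0 ≫ φ :=
    ProjectiveResolution.lift_commutes_zero φ P' P
  let l : ProjectiveResolution.Hom P' P φ :=
    ⟨ProjectiveResolution.lift φ P' P, hl⟩
  rw [ProjectiveResolution.mk₀_comp_extMk _ _ _ _ l,
    ProjectiveResolution.extMk_eq_zero_iff _ _ _ _ _ n rfl] at h
  obtain ⟨g, hg⟩ := h
  let ψ : P.complex.linearYonedaObj R M ⟶ P'.complex.linearYonedaObj R M :=
    (HomologicalComplex.unopFunctor _ _).map ((F.mapHomologicalComplex _).map l.hom).op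
  have key : (P.isoExt (R := R) (n + 1) M).inv ≫
        ((Ext R (ModuleCat.{u} R) (n + 1)).map φ.op).app M =
      HomologicalComplex.homologyMap ψ (n + 1) ≫ (P'.isoExt (R := R) (n + 1) M).inv := by
    have := P'.isoLeftDerivedObj_hom_naturality φ P l.hom hl F (n + 1)
    have h1 := HomologicalComplex.homologyOp_hom_naturality ψ (n + 1)
    have h2 : ((Ext R (ModuleCat.{u} R) (n + 1)).map φ.op).app M =
      ((F.leftDerived (n + 1)).map φ).unop := rfl
    have h3 := congrArg Quiver.Hom.unop this
    have h4 := congrArg Quiver.Hom.unop h1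
    have h5 {B : ModuleCat.{u} R} (Q : ProjectiveResolution B) : (Q.isoExt (R := R) (n + 1) M).inv =
      (HomologicalComplex.homologyOp (Q.complex.linearYonedaObj R M) (n + 1)).hom.unop ≫
        (Q.isoLeftDerivedObj F (n + 1)).hom.unop := rfl
    rw [h2, h5, h5]
    refine (Category.assoc _ _ _).trans ((congrArg (_ ≫ ·) h3).trans ?_)
    refine (Category.assoc _ _ _).symm.trans (.trans ?_ (Category.assoc _ _ _))
    exact congrArg (· ≫ _) h4
  rw [← hx, ← hc]
  have e1 := ConcreteCategory.congr_hom key ((P.complex.linearYonedaObj R M).homologyπ (n + 1) c)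
  have e2 := ConcreteCategory.congr_hom (HomologicalComplex.homologyπ_naturality ψ (n + 1)) c
  have e3 : HomologicalComplex.cyclesMap ψ (n + 1) c =
      (P'.complex.linearYonedaObj R M).toCycles n (n + 1) g := by
    apply (ModuleCat.mono_iff_injective
      ((P'.complex.linearYonedaObj R M).iCycles (n + 1))).1 inferInstance
    have e4 := ConcreteCategory.congr_hom (HomologicalComplex.cyclesMap_i ψ (n + 1)) c
    have e5 := ConcreteCategory.congr_hom
      ((P'.complex.linearYonedaObj R M).toCycles_i n (n + 1)) g
    exact e4.trans (hg.symm.trans e5.symm)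
  have e6 := ConcreteCategory.congr_hom
      ((P'.complex.linearYonedaObj R M).toCycles_comp_homologyπ n (n + 1)) g
  refine e1.trans ?_
  simp only [ModuleCat.comp_apply] at e2 e6 ⊢
  rw [e2, e3]
  exact (congrArg _ e6).trans (map_zero (ModuleCat.Hom.hom _))

open localCohomology in
theorem exists_localCohomology_rep {R : Type u} [CommRing R] (I : Ideal R) (i : ℕ)
    (M : ModuleCat.{u} R) (z : (localCohomology I i).obj M) :
    ∃ (j : ℕ)
      (ξ : ((Ext R (ModuleCat.{u} R) i).obj (Opposite.op (ModuleCat.of R (R ⧸ I ^ j)))).obj M),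
      (colimit.ι (diagram (idealPowersDiagram I) i) (Opposite.op (Opposite.op j))).app M ξ = z := by
  have : PreservesFilteredColimitsOfSize.{0, 0} (forget (ModuleCat.{u} R)) :=
    preservesFilteredColimitsOfSize_shrink.{0, u, 0, u} _
  obtain ⟨j, ξ, h⟩ := Concrete.isColimit_exists_rep _
    (isColimitOfPreserves ((evaluation _ _).obj M)
      (colimit.isColimit (diagram (idealPowersDiagram I) i))) z
  exact ⟨j.unop.unop, ξ, h⟩

open localCohomology in
theorem localCohomology_rep_map {R : Type u} [CommRing R] (I : Ideal R) (i : ℕ)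
    (M : ModuleCat.{u} R) {j k : ℕ} (hjk : j ≤ k)
    (ξ : ((Ext R (ModuleCat.{u} R) i).obj (Opposite.op (ModuleCat.of R (R ⧸ I ^ j)))).obj M) :
    (colimit.ι (diagram (idealPowersDiagram I) i) (Opposite.op (Opposite.op k))).app M
      (((Ext R (ModuleCat.{u} R) i).map (Ideal.quotMap
        (Ideal.pow_le_pow_right (I := I) hjk)).op).app M ξ) =
    (colimit.ι (diagram (idealPowersDiagram I) i) (Opposite.op (Opposite.op j))).app M ξ := by
  have := colimit.w (diagram (idealPowersDiagram I) i) (homOfLE hjk).op.op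
  exact ConcreteCategory.congr_hom (NatTrans.congr_app this M) ξ

instance linearYoneda_obj_preservesLimits {R : Type*} [Ring R]
    {C : Type*} [Category* C] [Preadditive C] [Linear R C] (X : C) :
    PreservesLimits ((linearYoneda R C).obj X) :=
  have : PreservesLimits ((linearYoneda R C).obj X ⋙ forget _) :=
    (inferInstance : PreservesLimits (yoneda.obj X))
  preservesLimits_of_reflects_of_preserves _ (forget _)

instance linearYoneda_obj_rightOp_preservesFiniteColimits (R : Type u) [CommRing R]
    (M : ModuleCat.{u} R) :
    PreservesFiniteColimits ((linearYoneda R (ModuleCat.{u} R)).obj M).rightOp :=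
  preservesFiniteColimits_rightOp _

theorem CategoryTheory.NatTrans.leftDerived_zero_comp_fromLeftDerivedZero {C D : Type*}
    [Category* C] [Category* D] [Abelian C] [HasProjectiveResolutions C] [Abelian D]
    {F G : C ⥤ D} [F.Additive] [G.Additive] (α : F ⟶ G) :
    NatTrans.leftDerived α 0 ≫ G.fromLeftDerivedZero = F.fromLeftDerivedZero ≫ α := by
  ext X
  let P := projectiveResolution X
  rw [NatTrans.comp_app, NatTrans.comp_app, P.fromLeftDerivedZero_eq, P.fromLeftDerivedZero_eq,
    ProjectiveResolution.leftDerived_app_eq α P]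
  simp only [Category.assoc, Iso.inv_hom_id_assoc, Iso.cancel_iso_hom_left]
  have : ProjectiveResolution.fromLeftDerivedZero' P F ≫ α.app X =
      HomologicalComplex.opcyclesMap
          ((NatTrans.mapHomologicalComplex α (ComplexShape.down ℕ)).app P.complex) 0 ≫
        ProjectiveResolution.fromLeftDerivedZero' P G := by
    rw [← cancel_epi (HomologicalComplex.pOpcycles _ _)]
    simp only [HomologicalComplex.p_opcyclesMap_assoc,
      ProjectiveResolution.pOpcycles_comp_fromLeftDerivedZero'_assoc,
      ProjectiveResolution.pOpcycles_comp_fromLeftDerivedZero']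
    exact α.naturality _
  refine .trans ?_ (Category.assoc _ _ _).symm
  refine .trans ?_ (congrArg (_ ≫ ·) this).symm
  exact HomologicalComplex.homologyι_naturality_assoc _ _ _

/-- `Ext⁰` is the functor of homomorphisms. -/
noncomputable def extZeroIso {R : Type u} [CommRing R] (A : ModuleCat.{u} R) :
    (linearCoyoneda R (ModuleCat.{u} R)).obj (Opposite.op A) ≅
      (Ext R (ModuleCat.{u} R) 0).obj (Opposite.op A) :=
  NatIso.ofComponents
    (fun N => (asIso (((linearYoneda R (ModuleCat.{u} R)).obj N).rightOp.fromLeftDerivedZero.app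
      A)).unop)
    (fun f => (congrArg Quiver.Hom.unop (NatTrans.congr_app
      (NatTrans.leftDerived_zero_comp_fromLeftDerivedZero
        (NatTrans.rightOp ((linearYoneda R (ModuleCat.{u} R)).map f))) A)).symm)

theorem extZeroIso_naturality {R : Type u} [CommRing R] {A B : ModuleCat.{u} R} (φ : A ⟶ B) :
    (linearCoyoneda R (ModuleCat.{u} R)).map φ.op ≫ (extZeroIso A).hom =
      (extZeroIso B).hom ≫ (Ext R (ModuleCat.{u} R) 0).map φ.op := by
  ext N : 2
  exact congrArg Quiver.Hom.unop
    (((linearYoneda R (ModuleCat.{u} R)).obj N).rightOp.fromLeftDerivedZero.naturality φ).symm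

/-- Evaluation of linear maps out of `R ⧸ I` at `1`. -/
def linearCoyonedaEval {R : Type u} [CommRing R] (I : Ideal R) :
    (linearCoyoneda R (ModuleCat.{u} R)).obj (Opposite.op (ModuleCat.of R (R ⧸ I))) ⟶ 𝟭 _ where
  app N := ModuleCat.ofHom
      { toFun := fun f : ModuleCat.of R (R ⧸ I) ⟶ N => f (Submodule.Quotient.mk 1)
        map_add' := fun _ _ => rfl
        map_smul' := fun _ _ => rfl }

theorem linearCoyonedaEval_injective {R : Type u} [CommRing R] (I : Ideal R) (N : ModuleCat.{u} R) :
    Function.Injective ((linearCoyonedaEval I).app N) := by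
  intro f g h
  refine ModuleCat.hom_ext (Submodule.linearMap_qext _ (LinearMap.ext_ring h))

theorem exists_linearCoyonedaEval_eq_iff {R : Type u} [CommRing R] (I : Ideal R)
    (N : ModuleCat.{u} R) (m : N) :
    (∃ f, (linearCoyonedaEval I).app N f = m) ↔ ∀ r ∈ I, r • m = 0 := by
  constructor
  · rintro ⟨f, rfl⟩ r hr
    change r • f.hom (Submodule.Quotient.mk 1) = 0
    rw [← map_smul, ← Submodule.Quotient.mk_smul, smul_eq_mul, mul_one,
      (Submodule.Quotient.mk_eq_zero I).2 hr, map_zero]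
  · intro h
    refine ⟨ModuleCat.ofHom (Submodule.liftQ I (LinearMap.toSpanSingleton R N m)
      fun r hr => h r hr), ?_⟩
    exact one_smul R m

/-- Evaluation at `1` as a natural transformation on `Ext⁰ (R ⧸ I)`. -/
noncomputable def extZeroEval {R : Type u} [CommRing R] (I : Ideal R) :
    (Ext R (ModuleCat.{u} R) 0).obj (Opposite.op (ModuleCat.of R (R ⧸ I))) ⟶ 𝟭 _ :=
  (extZeroIso _).inv ≫ linearCoyonedaEval I

theorem ext_map_quotMap_comp_extZeroEval {R : Type u} [CommRing R] {I J : Ideal R} (h : I ≤ J) :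
    (Ext R (ModuleCat.{u} R) 0).map (Ideal.quotMap h).op ≫ extZeroEval I = extZeroEval J := by
  rw [extZeroEval, extZeroEval, Iso.eq_inv_comp, ← Category.assoc, ← extZeroIso_naturality,
    Category.assoc, Iso.hom_inv_id_assoc]
  rfl

theorem extZeroEval_injective {R : Type u} [CommRing R] (I : Ideal R) (N : ModuleCat.{u} R) :
    Function.Injective ((extZeroEval I).app N) := by
  have h : Function.LeftInverse ((extZeroIso (ModuleCat.of R (R ⧸ I))).hom.app N)
      ((extZeroIso (ModuleCat.of R (R ⧸ I))).inv.app N) :=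
    ConcreteCategory.congr_hom ((extZeroIso (ModuleCat.of R (R ⧸ I))).inv_hom_id_app N)
  exact (linearCoyonedaEval_injective I N).comp h.injective

theorem exists_extZeroEval_eq_iff {R : Type u} [CommRing R] (I : Ideal R) (N : ModuleCat.{u} R)
    (m : N) : (∃ ξ, (extZeroEval I).app N ξ = m) ↔ ∀ r ∈ I, r • m = 0 := by
  rw [← exists_linearCoyonedaEval_eq_iff]
  refine ⟨fun ⟨ξ, h⟩ => ⟨_, h⟩, fun ⟨f, h⟩ => ⟨(extZeroIso _).hom.app N f, .trans ?_ h⟩⟩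
  exact congrArg ((linearCoyonedaEval I).app N)
    (ConcreteCategory.congr_hom ((extZeroIso (ModuleCat.of R (R ⧸ I))).hom_inv_id_app N) f)

open localCohomology in
/-- The cocone over the system `Ext⁰ (R ⧸ I ^ j)` given by evaluation at `1`. -/
noncomputable def localCohomologyZeroCocone {R : Type u} [CommRing R] (I : Ideal R) :
    Cocone (diagram.{u, 0} (idealPowersDiagram I) 0) where
  pt := 𝟭 _
  ι :=
    { app := fun j => extZeroEval (I ^ j.unop.unop)
      naturality := fun _ _ f =>
        (ext_map_quotMap_comp_extZeroEval
          (Ideal.pow_le_pow_right (I := I) (leOfHom f.unop.unop))).trans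
          (Category.comp_id _).symm }

/-- The natural map from local cohomology in degree zero to the identity. -/
noncomputable def localCohomologyZeroTo {R : Type u} [CommRing R] (I : Ideal R) :
    localCohomology I 0 ⟶ 𝟭 (ModuleCat.{u} R) :=
  colimit.desc _ (localCohomologyZeroCocone I)

open localCohomology in
theorem localCohomologyZeroTo_rep {R : Type u} [CommRing R] (I : Ideal R) (N : ModuleCat.{u} R)
    (j : ℕ)
    (ξ : ((Ext R (ModuleCat.{u} R) 0).obj (Opposite.op (ModuleCat.of R (R ⧸ I ^ j)))).obj N) :
    (localCohomologyZeroTo I).app N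
      ((colimit.ι (diagram (idealPowersDiagram I) 0) (Opposite.op (Opposite.op j))).app N ξ) =
      (extZeroEval (I ^ j)).app N ξ :=
  ConcreteCategory.congr_hom (NatTrans.congr_app
    (colimit.ι_desc (localCohomologyZeroCocone I) (Opposite.op (Opposite.op j))) N) ξ

theorem localCohomologyZeroTo_injective {R : Type u} [CommRing R] (I : Ideal R)
    (N : ModuleCat.{u} R) : Function.Injective ((localCohomologyZeroTo I).app N) := by
  refine (injective_iff_map_eq_zero ((localCohomologyZeroTo I).app N).hom).2 fun z hz => ?_
  obtain ⟨j, ξ, rfl⟩ := exists_localCohomology_rep I 0 N z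
  have h : ξ = 0 := extZeroEval_injective _ N
    ((localCohomologyZeroTo_rep I N j ξ).symm.trans
      (hz.trans (map_zero ((extZeroEval (I ^ j)).app N).hom).symm))
  rw [h]
  exact map_zero (ModuleCat.Hom.hom _)

theorem range_localCohomologyZeroTo {R : Type u} [CommRing R] (I : Ideal R) (N : ModuleCat.{u} R) :
    LinearMap.range ((localCohomologyZeroTo I).app N).hom = I.powTorsion N := by
  ext m
  constructor
  · rintro ⟨z, rfl⟩
    obtain ⟨j, ξ, rfl⟩ := exists_localCohomology_rep I 0 N z
    refine ⟨j + 1, by lia, fun r hr => ?_⟩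
    exact (congrArg (r • ·) (localCohomologyZeroTo_rep I N j ξ)).trans
      ((exists_extZeroEval_eq_iff _ _ _).1 ⟨ξ, rfl⟩ r (Ideal.pow_le_pow_right j.le_succ hr))
  · rintro ⟨j, -, hj⟩
    obtain ⟨ξ, hξ⟩ := (exists_extZeroEval_eq_iff (I ^ j) N m).2 hj
    exact ⟨_, (localCohomologyZeroTo_rep I N j ξ).trans hξ⟩

/-- Local cohomology in degree zero is the `I`-power torsion submodule. -/
noncomputable def localCohomologyZeroEquiv {R : Type u} [CommRing R] (I : Ideal R)
    (N : ModuleCat.{u} R) : (localCohomology I 0).obj N ≃ₗ[R] I.powTorsion N :=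
  (LinearEquiv.ofInjective ((localCohomologyZeroTo I).app N).hom
    (localCohomologyZeroTo_injective I N)).trans
    (LinearEquiv.ofEq _ _ (range_localCohomologyZeroTo I N))

theorem coe_localCohomologyZeroEquiv {R : Type u} [CommRing R] (I : Ideal R)
    (N : ModuleCat.{u} R) (x : (localCohomology I 0).obj N) :
    (localCohomologyZeroEquiv I N x : N) = (localCohomologyZeroTo I).app N x := rfl

theorem subsingleton_localCohomology_succ {R : Type u} [CommRing R] (l : List R)
    (hl : IsWeaklyRegular R l) (M : ModuleCat.{u} R)
    (hM : ∀ x ∈ l, ∀ m : M, ∃ N : ℕ, x ^ N • m = 0) (i : ℕ) :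
    Subsingleton ((localCohomology (Ideal.ofList l) (i + 1)).obj M) := by
  refine subsingleton_of_forall_eq 0 fun z => ?_
  obtain ⟨j, ξ, rfl⟩ := exists_localCohomology_rep _ _ M z
  obtain ⟨η, hη⟩ := Ext_map_eq_zero_of_comp i ξ
  have hle : Ideal.ofList (l.map (· ^ j)) ≤ Ideal.ofList l ^ j := by
    refine Ideal.span_le.2 fun y hy => ?_
    obtain ⟨a, ha, rfl⟩ := List.mem_map.1 hy
    exact Ideal.pow_mem_pow (show a ∈ Ideal.ofList l from Ideal.subset_span ha) j
  obtain ⟨k, hjk, hk, h⟩ := ExtProZero.ofList l hl M hM i j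
    ((Abelian.Ext.mk₀ (Ideal.quotMap hle)).comp η (zero_add _))
  obtain ⟨m, hm⟩ := Ideal.exists_pow_le_of_le_radical_of_fg
    (I := Ideal.ofList l) (J := Ideal.ofList (l.map (· ^ k)))
    (Ideal.span_le.2 fun a ha => ⟨k, Ideal.subset_span (List.mem_map.2 ⟨a, ha, rfl⟩)⟩)
    ((Submodule.fg_span (R := R) (List.finite_toSet l)))
  have hm' := (Ideal.pow_le_pow_right (I := Ideal.ofList l) (le_max_left m j)).trans hm
  rw [← localCohomology_rep_map _ _ _ (le_max_right m j), hη]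
  · exact map_zero (ModuleCat.Hom.hom _)
  · have e := congrArg ((Abelian.Ext.mk₀ (Ideal.quotMap hm')).comp · (zero_add _)) h
    simpa only [Abelian.Ext.mk₀_comp_mk₀_assoc, Ideal.quotMap_comp, Abelian.Ext.comp_zero] using e

/-- For a regular sequence `α_0, …, α_n` of non-zero-divisors generating `I`
and an `I`-power torsion module `M`, the natural map `H_I^0(M) → M` (the composite of the
natural isomorphism of `H_I^0` with the `I`-power torsion submodule functor and the inclusion)
is an isomorphism, and `H_I^i(M) = 0` for all `i > 0`. -/
theorem stmt14 {R : Type u} [CommRing R] (n : ℕ) (α : Fin (n + 1) → R)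
    (hreg : RingTheory.Sequence.IsWeaklyRegular R (List.ofFn α))
    (hnzd : ∀ i, α i ∈ nonZeroDivisors R)
    (M : Type u) [AddCommGroup M] [Module R M]
    (htors : ∀ m : M, ∃ j : ℕ, 1 ≤ j ∧
      ∀ r ∈ (Ideal.span (Set.range α)) ^ j, r • m = 0) :
    (∃ e : ∀ N : ModuleCat.{u} R,
        ((localCohomology (Ideal.span (Set.range α)) 0).obj N) ≃ₗ[R]
          (Ideal.span (Set.range α)).powTorsion N,
      (∀ (N N' : ModuleCat.{u} R) (f : N ⟶ N')
          (x : (localCohomology (Ideal.span (Set.range α)) 0).obj N),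
        ((e N' ((localCohomology (Ideal.span (Set.range α)) 0).map f x) :
            (Ideal.span (Set.range α)).powTorsion N') : N') = f ((e N x : _) : N)) ∧
      Function.Bijective (fun x => Subtype.val (e (ModuleCat.of R M) x))) ∧
    (∀ i : ℕ, 0 < i →
      Subsingleton ((localCohomology (Ideal.span (Set.range α)) i).obj (ModuleCat.of R M))) := by
  have hI : Ideal.span (Set.range α) = Ideal.ofList (List.ofFn α) :=
    congrArg Ideal.span (Set.ext fun x => (List.mem_ofFn' α x).symm)
  refine ⟨⟨localCohomologyZeroEquiv _, fun N N' f x => ?_, ?_⟩, fun i hi => ?_⟩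
  · simp only [coe_localCohomologyZeroEquiv]
    exact ConcreteCategory.congr_hom ((localCohomologyZeroTo _).naturality f) x
  · exact ⟨Subtype.val_injective.comp (LinearEquiv.injective _),
      fun m => ⟨(localCohomologyZeroEquiv _ _).symm ⟨m, htors m⟩,
        congrArg Subtype.val (LinearEquiv.apply_symm_apply _ _)⟩⟩
  · obtain ⟨i, rfl⟩ := Nat.exists_eq_succ_of_ne_zero hi.ne'
    rw [hI]
    refine subsingleton_localCohomology_succ _ hreg _ (fun x hx m => ?_) i
    obtain ⟨a, rfl⟩ := List.mem_ofFn.1 hx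
    obtain ⟨j, -, hj⟩ := htors m
    exact ⟨j, hj _ (Ideal.pow_mem_pow (Ideal.subset_span (Set.mem_range_self a)) j)⟩
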